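/- arXiv:2302.09220 — 3 statements merged into one kernel-verified Lean document; each statement's English description precedes it below -/
import Mathlib

section
/- Let X be a finite set of variables, r ≥ 2 a natural number, i, j ∈ Fin r with i ≠ j, and let a : D_a → Bool and b : D_b → Bool be partial assignments on finite sets of variables D_a, D_b ⊆ X. Then the sets S(i, a) and S(j, b) are disjoint if and only if a and b are consistent, i.e., a x = b x for every x ∈ D_a ∩ D_b. -/
/-- The gadget set `S(i, a)` for index `i : Fin r` and a partial assignment with
domain `D` (values given by `a`): for each `x ∈ D`, if `a x = false` it contains
`(x, i, q)` for all `q`, and if `a x = true` it contains `(x, p, i)` for all `p`. -/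
def gadgetS {X : Type*} (r : ℕ) (i : Fin r) (D : Finset X) (a : X → Bool) :
    Set (X × Fin r × Fin r) :=
  {t | t.1 ∈ D ∧ ((a t.1 = false ∧ t.2.1 = i) ∨ (a t.1 = true ∧ t.2.2 = i))}

/-- For distinct indices `i ≠ j`, the gadget sets `S(i, a)` and `S(j, b)` are
disjoint iff the partial assignments `a` (on `D_a`) and `b` (on `D_b`) are
consistent, i.e. agree on `D_a ∩ D_b`. -/
theorem gadget_disjoint_iff_consistent {X : Type*} [Fintype X] [DecidableEq X]
    (r : ℕ) (hr : 2 ≤ r) (i j : Fin r) (hij : i ≠ j)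
    (Da Db : Finset X) (a b : X → Bool) :
    Disjoint (gadgetS r i Da a) (gadgetS r j Db b) ↔
      ∀ x ∈ Da ∩ Db, a x = b x := by
  rw [Set.disjoint_left]
  constructor
  · intro h x hx
    obtain ⟨ha, hb⟩ := Finset.mem_inter.mp hx
    cases hA : a x <;> cases hB : b x
    · rfl
    · exact (h (a := (x, i, j)) ⟨ha, Or.inl ⟨hA, rfl⟩⟩ ⟨hb, Or.inr ⟨hB, rfl⟩⟩).elim
    · exact (h (a := (x, j, i)) ⟨ha, Or.inr ⟨hA, rfl⟩⟩ ⟨hb, Or.inl ⟨hB, rfl⟩⟩).elim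
    · rfl
  · rintro h ⟨x, p, q⟩ ⟨ha, h1⟩ ⟨hb, h2⟩
    have hab := h x (Finset.mem_inter.mpr ⟨ha, hb⟩)
    simp only at h1 h2
    rcases h1 with ⟨h1, e1⟩ | ⟨h1, e1⟩ <;> rcases h2 with ⟨h2, e2⟩ | ⟨h2, e2⟩
    · exact hij (e1.symm.trans e2)
    · simp [h1, h2] at hab
    · simp [h1, h2] at hab
    · exact hij (e1.symm.trans e2)
end

section
/- Let φ be a CNF formula over a finite variable set X in which every clause is nonempty, and let the clauses of φ be partitioned into r nonempty groups C_1, …, C_r (r ≥ 1). Suppose there exist indices i_1, …, i_r ∈ Fin r and partial assignments a_1 ∈ A_{i_1}, …, a_r ∈ A_{i_r} such that the r sets S(i_1, a_1), …, S(i_r, a_r) are pairwise disjoint. Then φ is satisfiable. -/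
/-- The set of variables occurring in some clause of a set of clauses `𝒞`. -/
def cnfVars {X : Type*} [DecidableEq X] (𝒞 : Finset (Finset (X × Bool))) : Finset X :=
  𝒞.biUnion (fun C => C.image Prod.fst)

/-- If the clauses of `φ` (all nonempty) are partitioned into `r` nonempty groups
`C i`, and there are indices `idx k` and partial assignments `a k ∈ A (idx k)`
(i.e. `a k` satisfies every clause of `C (idx k)`, viewed on the domain
`v(C (idx k))`) such that the `r` gadget sets `S(idx k, a k)` are pairwise
disjoint, then `φ` is satisfiable. -/
theorem satisfiable_of_pairwise_disjoint_gadgets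
    {X : Type*} [Fintype X] [DecidableEq X]
    (φ : Finset (Finset (X × Bool))) (hφ : ∀ cl ∈ φ, cl.Nonempty)
    (r : ℕ) (hr : 1 ≤ r)
    (C : Fin r → Finset (Finset (X × Bool)))
    (hdisj : ∀ i j : Fin r, i ≠ j → Disjoint (C i) (C j))
    (hcover : Finset.univ.biUnion C = φ)
    (hC : ∀ i : Fin r, (C i).Nonempty)
    (idx : Fin r → Fin r) (a : Fin r → X → Bool)
    (hA : ∀ k : Fin r, ∀ cl ∈ C (idx k), ∃ l ∈ cl, a k l.1 = l.2)
    (hSdisj : ∀ k l : Fin r, k ≠ l →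
      Disjoint (gadgetS r (idx k) (cnfVars (C (idx k))) (a k))
               (gadgetS r (idx l) (cnfVars (C (idx l))) (a l))) :
    ∃ α : X → Bool, ∀ cl ∈ φ, ∃ l ∈ cl, α l.1 = l.2 := by
  have key : ∀ k l : Fin r, k ≠ l → ∀ t,
      t ∈ gadgetS r (idx k) (cnfVars (C (idx k))) (a k) →
      t ∈ gadgetS r (idx l) (cnfVars (C (idx l))) (a l) → False :=
    fun k l h t h1 h2 => Set.disjoint_left.mp (hSdisj k l h) h1 h2
  have hinj : Function.Injective idx := by
    intro k l hkl
    by_contra hne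
    obtain ⟨cl, hcl⟩ := hC (idx k)
    obtain ⟨y, hy, -⟩ := hA k cl hcl
    have hx : y.1 ∈ cnfVars (C (idx k)) :=
      Finset.mem_biUnion.mpr ⟨cl, hcl, Finset.mem_image_of_mem _ hy⟩
    refine key k l hne (y.1, idx k, idx k) ⟨hx, ?_⟩ ⟨hkl ▸ hx, ?_⟩
    · cases h : a k y.1 <;> simp [h]
    · cases h : a l y.1 <;> simp [h, hkl]
  have hsurj : Function.Surjective idx := Finite.surjective_of_injective hinj
  classical
  refine ⟨fun x => decide (∃ k, x ∈ cnfVars (C (idx k)) ∧ a k x = true), ?_⟩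
  intro cl hcl
  rw [← hcover] at hcl
  obtain ⟨i, -, hi⟩ := Finset.mem_biUnion.mp hcl
  obtain ⟨k, rfl⟩ := hsurj i
  obtain ⟨y, hy, hay⟩ := hA k cl hi
  have hx : y.1 ∈ cnfVars (C (idx k)) :=
    Finset.mem_biUnion.mpr ⟨cl, hi, Finset.mem_image_of_mem _ hy⟩
  refine ⟨y, hy, ?_⟩
  cases h : y.2 with
  | true => exact decide_eq_true ⟨k, hx, hay.trans h⟩
  | false =>
    refine decide_eq_false ?_
    rintro ⟨l, hl, hal⟩
    have hk : a k y.1 = false := hay.trans h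
    have hne : k ≠ l := by
      rintro rfl
      simp [hk] at hal
    exact key k l hne (y.1, idx k, idx l) ⟨hx, Or.inl ⟨hk, rfl⟩⟩ ⟨hl, Or.inr ⟨hal, rfl⟩⟩
end

section
/- Let φ be a CNF formula over a finite variable set X in which every clause is nonempty, and let the clauses of φ be partitioned into r nonempty groups C_1, …, C_r (r ≥ 1). Then φ is satisfiable if and only if there exist indices i_1, …, i_r ∈ Fin r and partial assignments a_1 ∈ A_{i_1}, …, a_r ∈ A_{i_r} such that the r sets S(i_1, a_1), …, S(i_r, a_r) are pairwise disjoint. -/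
/-- A CNF formula `φ` with nonempty clauses, partitioned into `r` nonempty groups
`C i`, is satisfiable iff there exist indices `idx k` and partial assignments
`a k ∈ A (idx k)` such that the `r` gadget sets `S(idx k, a k)` are pairwise
disjoint. -/
theorem satisfiable_iff_pairwise_disjoint_gadgets
    {X : Type*} [Fintype X] [DecidableEq X]
    (φ : Finset (Finset (X × Bool))) (hφ : ∀ cl ∈ φ, cl.Nonempty)
    (r : ℕ) (hr : 1 ≤ r)
    (C : Fin r → Finset (Finset (X × Bool)))
    (hdisj : ∀ i j : Fin r, i ≠ j → Disjoint (C i) (C j))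
    (hcover : Finset.univ.biUnion C = φ)
    (hC : ∀ i : Fin r, (C i).Nonempty) :
    (∃ α : X → Bool, ∀ cl ∈ φ, ∃ l ∈ cl, α l.1 = l.2) ↔
      (∃ (idx : Fin r → Fin r) (a : Fin r → X → Bool),
        (∀ k : Fin r, ∀ cl ∈ C (idx k), ∃ l ∈ cl, a k l.1 = l.2) ∧
        (∀ k l : Fin r, k ≠ l →
          Disjoint (gadgetS r (idx k) (cnfVars (C (idx k))) (a k))
                   (gadgetS r (idx l) (cnfVars (C (idx l))) (a l)))) := by
  constructor
  · rintro ⟨α, hα⟩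
    refine ⟨id, fun _ => α, ?_, ?_⟩
    · intro k cl hcl
      apply hα
      rw [← hcover]
      exact Finset.mem_biUnion.2 ⟨k, Finset.mem_univ _, hcl⟩
    · intro k l hkl
      rw [Set.disjoint_left]
      rintro ⟨x, p, q⟩ ⟨_, h1⟩ ⟨_, h2⟩
      simp only [id] at h1 h2
      rcases h1 with ⟨h1, h1'⟩ | ⟨h1, h1'⟩ <;> rcases h2 with ⟨h2, h2'⟩ | ⟨h2, h2'⟩
      · exact hkl (h1'.symm.trans h2')
      · simp [h1] at h2
      · simp [h1] at h2
      · exact hkl (h1'.symm.trans h2')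
  · rintro ⟨idx, a, hsat, hd⟩
    have key : ∀ k l : Fin r, k ≠ l → ∀ x, x ∈ cnfVars (C (idx k)) → x ∈ cnfVars (C (idx l)) →
        a k x = a l x ∧ idx k ≠ idx l := by
      intro k l hkl x hk hl
      have h := Set.disjoint_left.1 (hd k l hkl)
      have h' : ∀ p q : Fin r,
          ((a k x = false ∧ p = idx k) ∨ (a k x = true ∧ q = idx k)) →
          ((a l x = false ∧ p = idx l) ∨ (a l x = true ∧ q = idx l)) → False :=
        fun p q h1 h2 => h (a := (x, p, q)) ⟨hk, h1⟩ ⟨hl, h2⟩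
      have e1 := h' (idx k) (idx l)
      have e2 := h' (idx l) (idx k)
      cases hx : a k x <;> cases hy : a l x <;> simp only [hx, hy] at e1 e2 ⊢ <;> clear h h' hd hsat <;> grind
    have hvar : ∀ i, ∀ cl ∈ C i, ∀ l ∈ cl, l.1 ∈ cnfVars (C i) := by
      intro i cl hcl l hl
      exact Finset.mem_biUnion.2 ⟨cl, hcl, Finset.mem_image_of_mem _ hl⟩
    have hinj : Function.Injective idx := by
      intro k l hkl
      by_contra hne
      obtain ⟨cl, hcl⟩ := hC (idx k)
      have hclφ : cl ∈ φ := by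
        rw [← hcover]
        exact Finset.mem_biUnion.2 ⟨_, Finset.mem_univ _, hcl⟩
      obtain ⟨t, ht⟩ := hφ cl hclφ
      have hx := hvar _ cl hcl t ht
      exact (key k l hne t.1 hx (hkl ▸ hx)).2 hkl
    have hsurj := Finite.surjective_of_injective hinj
    classical
    refine ⟨fun x => decide (∃ k, x ∈ cnfVars (C (idx k)) ∧ a k x = true), ?_⟩
    intro cl hcl
    rw [← hcover] at hcl
    obtain ⟨i, -, hi⟩ := Finset.mem_biUnion.1 hcl
    obtain ⟨k, rfl⟩ := hsurj i
    obtain ⟨t, ht, hat⟩ := hsat k cl hi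
    refine ⟨t, ht, ?_⟩
    have hx := hvar _ cl hi t ht
    rw [← hat, Bool.eq_iff_iff, decide_eq_true_iff]
    constructor
    · rintro ⟨l, hl, hal⟩
      by_cases hkl : k = l
      · rw [hkl]; exact hal
      · rw [(key k l hkl t.1 hx hl).1]; exact hal
    · exact fun h => ⟨k, hx, h⟩
end
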